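/- arXiv:2409.06437 — 2 statements merged into one kernel-verified Lean document; each statement's English description precedes it below -/
import Mathlib

section
/- Let A, B ∈ ℝ^{d×d} and n ≥ 1, and set G = L_A^{−1} · L_B. Then for each i with 1 ≤ i ≤ n, the i-th diagonal d×d block of G·Gᵀ equals I_d + Σ_{k=1}^{i−1} (B^k − A·B^{k−1})(B^k − A·B^{k−1})ᵀ (the empty sum for i = 1 being 0). -/
open Matrix

/-- The `nd × nd` block lower-triangular Toeplitz matrix whose `(i,j)` block
(for `j ≤ i`) is `A ^ (i - j)` and whose blocks above the diagonal vanish. -/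
noncomputable def blockToeplitz (d n : ℕ) (A : Matrix (Fin d) (Fin d) ℝ) :
    Matrix (Fin n × Fin d) (Fin n × Fin d) ℝ :=
  fun p q => if (q.1 : ℕ) ≤ (p.1 : ℕ) then (A ^ ((p.1 : ℕ) - (q.1 : ℕ))) p.2 q.2 else 0

/-- The block lower-triangular Toeplitz matrix with blocks `f (i - j)`. -/
def seqToeplitz (d n : ℕ) (f : ℕ → Matrix (Fin d) (Fin d) ℝ) :
    Matrix (Fin n × Fin d) (Fin n × Fin d) ℝ :=
  fun p q => if (q.1 : ℕ) ≤ (p.1 : ℕ) then f ((p.1 : ℕ) - (q.1 : ℕ)) p.2 q.2 else 0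

/-- The blocks `1, B - A, B ^ 2 - A * B, …` of `L_A⁻¹ * L_B`. -/
def quotientBlock {d : ℕ} (A B : Matrix (Fin d) (Fin d) ℝ) (k : ℕ) : Matrix (Fin d) (Fin d) ℝ :=
  if k = 0 then 1 else B ^ k - A * B ^ (k - 1)

lemma sum_pow_mul_quotientBlock {d : ℕ} (A B : Matrix (Fin d) (Fin d) ℝ) (r : ℕ) :
    ∑ k ∈ Finset.range (r + 1), A ^ (r - k) * quotientBlock A B k = B ^ r := by
  induction r with
  | zero => simp [quotientBlock]
  | succ r ih =>
    rw [Finset.sum_range_succ]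
    have h : ∑ k ∈ Finset.range (r + 1), A ^ (r + 1 - k) * quotientBlock A B k = A * B ^ r := by
      rw [← ih, Finset.mul_sum]
      refine Finset.sum_congr rfl fun k hk => ?_
      have hk' : k ≤ r := Nat.lt_succ_iff.mp (Finset.mem_range.mp hk)
      rw [Nat.succ_sub hk', pow_succ', mul_assoc]
    rw [h]
    simp [quotientBlock]

lemma sum_fin_ite_between {M : Type*} [AddCommMonoid M] {n i j : ℕ} (hi : i < n) (F : ℕ → M) :
    (∑ m : Fin n, if j ≤ (m : ℕ) ∧ (m : ℕ) ≤ i then F m else 0) =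
      ∑ k ∈ Finset.range (i + 1 - j), F (j + k) := by
  rw [Fin.sum_univ_eq_sum_range (fun m => if j ≤ m ∧ m ≤ i then F m else 0) n,
    ← Finset.sum_filter, ← Finset.sum_Ico_eq_sum_range]
  refine Finset.sum_congr ?_ fun _ _ => rfl
  ext m
  simp only [Finset.mem_filter, Finset.mem_range, Finset.mem_Ico]
  omega

lemma blockToeplitz_mul_seqToeplitz (d n : ℕ) (A B : Matrix (Fin d) (Fin d) ℝ) :
    blockToeplitz d n A * seqToeplitz d n (quotientBlock A B) = blockToeplitz d n B := by
  ext ⟨i, a⟩ ⟨j, b⟩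
  have h : (blockToeplitz d n A * seqToeplitz d n (quotientBlock A B)) (i, a) (j, b) =
      ∑ m : Fin n, if (j : ℕ) ≤ (m : ℕ) ∧ (m : ℕ) ≤ i then
        (A ^ ((i : ℕ) - m) * quotientBlock A B (m - j)) a b else 0 := by
    rw [Matrix.mul_apply, Fintype.sum_prod_type]
    refine Finset.sum_congr rfl fun m _ => ?_
    by_cases h1 : (m : ℕ) ≤ i <;> by_cases h2 : (j : ℕ) ≤ m <;>
      simp only [blockToeplitz, seqToeplitz, h1, h2, Matrix.mul_apply, if_true, if_false, and_true,
        and_false, and_self, mul_zero, zero_mul, Finset.sum_const_zero]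
  rw [h, sum_fin_ite_between i.isLt
    (fun m => (A ^ ((i : ℕ) - m) * quotientBlock A B (m - j)) a b)]
  unfold blockToeplitz
  split_ifs with hij
  · dsimp only at hij ⊢
    rw [← sum_pow_mul_quotientBlock A B, Matrix.sum_apply, Nat.succ_sub hij]
    simp only [Nat.add_sub_cancel_left, Nat.sub_sub]
  · dsimp only at hij
    rw [show (i : ℕ) + 1 - j = 0 by omega, Finset.sum_range_zero]

lemma blockToeplitz_zero (d n : ℕ) : blockToeplitz d n 0 = 1 := by
  ext ⟨i, a⟩ ⟨j, b⟩
  simp only [blockToeplitz, Matrix.one_apply, Prod.mk.injEq]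
  rcases lt_trichotomy (i : ℕ) j with h | h | h
  · have hne : i ≠ j := fun e => by simp [e] at h
    simp [hne, h.not_ge]
  · obtain rfl := Fin.ext h
    simp [Matrix.one_apply]
  · have hne : i ≠ j := fun e => by simp [e] at h
    rw [if_pos h.le, zero_pow (Nat.sub_ne_zero_of_lt h)]
    simp [hne]

lemma inv_blockToeplitz_mul (d n : ℕ) (A B : Matrix (Fin d) (Fin d) ℝ) :
    (blockToeplitz d n A)⁻¹ * blockToeplitz d n B = seqToeplitz d n (quotientBlock A B) := by
  have hA := blockToeplitz_mul_seqToeplitz d n A 0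
  rw [blockToeplitz_zero] at hA
  rw [← blockToeplitz_mul_seqToeplitz d n A B,
    Matrix.nonsing_inv_mul_cancel_left _ _ (Matrix.isUnit_det_of_right_inverse hA)]

theorem diag_blocks_of_GGT (d n : ℕ) (hd : 1 ≤ d) (hn : 1 ≤ n)
    (A B : Matrix (Fin d) (Fin d) ℝ)
    (G : Matrix (Fin n × Fin d) (Fin n × Fin d) ℝ)
    (hG : G = (blockToeplitz d n A)⁻¹ * blockToeplitz d n B)
    (i : Fin n) (a b : Fin d) :
    (G * Gᵀ) (i, a) (i, b) =
      ((1 : Matrix (Fin d) (Fin d) ℝ) +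
        ∑ k ∈ Finset.Icc 1 (i : ℕ),
          (B ^ k - A * B ^ (k - 1)) * (B ^ k - A * B ^ (k - 1))ᵀ) a b := by
  rw [hG, inv_blockToeplitz_mul]
  set c := quotientBlock A B with hc
  have h : (seqToeplitz d n c * (seqToeplitz d n c)ᵀ) (i, a) (i, b) =
      ∑ m : Fin n, if 0 ≤ (m : ℕ) ∧ (m : ℕ) ≤ i then (c (i - m) * (c (i - m))ᵀ) a b else 0 := by
    rw [Matrix.mul_apply, Fintype.sum_prod_type]
    refine Finset.sum_congr rfl fun m _ => ?_
    by_cases h1 : (m : ℕ) ≤ i <;> simp [seqToeplitz, h1, Matrix.mul_apply]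
  rw [h, sum_fin_ite_between i.isLt (fun m => (c (i - m) * (c (i - m))ᵀ) a b)]
  have hr := Finset.sum_range_reflect (fun k => (c k * (c k)ᵀ) a b) ((i : ℕ) + 1)
  simp only [Nat.add_sub_cancel] at hr
  simp only [Nat.sub_zero, zero_add]
  rw [hr, ← Matrix.sum_apply, Finset.sum_range_succ', add_comm,
    ← Finset.Ico_add_one_right_eq_Icc, Finset.sum_Ico_eq_sum_range]
  simp [hc, quotientBlock, add_comm 1]
end

section
/- Let A, B ∈ ℝ^{d×d} and n ≥ 1, and set Σ_A = L_A L_Aᵀ and Σ_B = L_B L_Bᵀ. Then tr( Σ_A^{−1} Σ_B − I_{nd} ) = tr( (B − A)ᵀ (B − A) · Σ_{i=1}^{n} Σ_{k=1}^{i−1} B^{k−1} (B^{k−1})ᵀ ), where the inner sum is empty (equal to 0) for i = 1. -/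
open Matrix

/-- The block lower-triangular Toeplitz matrix whose `(i,j)` block (for `j ≤ i`) is the
coefficient of index `i - j` of a power series with matrix coefficients. -/
noncomputable def seriesToeplitz (d n : ℕ) (φ : PowerSeries (Matrix (Fin d) (Fin d) ℝ)) :
    Matrix (Fin n × Fin d) (Fin n × Fin d) ℝ :=
  fun p q => if (q.1 : ℕ) ≤ (p.1 : ℕ) then
    (PowerSeries.coeff ((p.1 : ℕ) - (q.1 : ℕ)) φ) p.2 q.2 else 0

theorem sum_fin_between_eq_sum_antidiagonal {M : Type*} [AddCommMonoid M] {n p q : ℕ}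
    (hp : p < n) (hqp : q ≤ p) (F : ℕ → ℕ → M) :
    ∑ r : Fin n, (if (r : ℕ) ≤ p ∧ q ≤ (r : ℕ) then F (p - r) (r - q) else 0) =
      ∑ ij ∈ Finset.HasAntidiagonal.antidiagonal (p - q), F ij.1 ij.2 := by
  rw [Fin.sum_univ_eq_sum_range
    (fun r => if r ≤ p ∧ q ≤ r then F (p - r) (r - q) else 0) n, ← Finset.sum_filter]
  refine Finset.sum_nbij' (fun r => (p - r, r - q)) (fun ij => ij.2 + q) ?_ ?_ ?_ ?_ ?_
  · intro r hr
    simp only [Finset.mem_filter, Finset.mem_range, Finset.HasAntidiagonal.mem_antidiagonal] at *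
    omega
  · intro r hr
    simp only [Finset.mem_filter, Finset.mem_range, Finset.HasAntidiagonal.mem_antidiagonal] at *
    omega
  · intro r hr
    simp only [Finset.mem_filter, Finset.mem_range] at *
    omega
  · rintro ⟨i, j⟩ hr
    simp only [Finset.HasAntidiagonal.mem_antidiagonal, Prod.mk.injEq] at *
    omega
  · intro r _
    rfl

theorem sum_fin_le_eq_sum_range {M : Type*} [AddCommMonoid M] {n p : ℕ} (hp : p < n)
    (F : ℕ → M) :
    ∑ r : Fin n, (if (r : ℕ) ≤ p then F (p - r) else 0) = ∑ k ∈ Finset.range (p + 1), F k := by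
  have h := sum_fin_between_eq_sum_antidiagonal hp (Nat.zero_le p) (fun i _ => F i)
  rw [Finset.Nat.sum_antidiagonal_eq_sum_range_succ_mk] at h
  simpa using h

theorem seriesToeplitz_mul (d n : ℕ) (φ ψ : PowerSeries (Matrix (Fin d) (Fin d) ℝ)) :
    seriesToeplitz d n φ * seriesToeplitz d n ψ = seriesToeplitz d n (φ * ψ) := by
  ext ⟨p, a⟩ ⟨q, b⟩
  simp only [Matrix.mul_apply, seriesToeplitz, Fintype.sum_prod_type]
  split_ifs with hqp
  · rw [PowerSeries.coeff_mul, Matrix.sum_apply]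
    simp only [Matrix.mul_apply]
    rw [← sum_fin_between_eq_sum_antidiagonal p.2 hqp
      (fun i j => ∑ s, PowerSeries.coeff i φ a s * PowerSeries.coeff j ψ s b)]
    refine Finset.sum_congr rfl fun r _ => ?_
    by_cases h₁ : (r : ℕ) ≤ p <;> by_cases h₂ : (q : ℕ) ≤ r <;> simp [-Fin.val_fin_le, h₁, h₂]
  · refine Finset.sum_eq_zero fun r _ => Finset.sum_eq_zero fun s _ => ?_
    by_cases h₁ : (r : ℕ) ≤ p
    · have h₂ : ¬ (q : ℕ) ≤ r := by omega
      rw [if_neg h₂, mul_zero]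
    · rw [if_neg h₁, zero_mul]

theorem seriesToeplitz_one (d n : ℕ) : seriesToeplitz d n 1 = 1 := by
  ext ⟨p, a⟩ ⟨q, b⟩
  simp only [seriesToeplitz, PowerSeries.coeff_one, Matrix.one_apply, Prod.mk.injEq, Fin.ext_iff]
  by_cases h : (p : ℕ) = q
  · simp [h, Matrix.one_apply, Fin.ext_iff]
  · by_cases h₁ : (q : ℕ) ≤ p
    · have h₂ : ¬ (p : ℕ) - q = 0 := by omega
      simp [-Fin.val_fin_le, h, h₁, h₂]
    · simp [-Fin.val_fin_le, h, h₁]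

theorem blockToeplitz_eq_seriesToeplitz (d n : ℕ) (A : Matrix (Fin d) (Fin d) ℝ) :
    blockToeplitz d n A = seriesToeplitz d n (PowerSeries.mk fun k => A ^ k) := by
  ext p q
  simp only [blockToeplitz, seriesToeplitz, PowerSeries.coeff_mk]

theorem one_sub_C_mul_X_mul_mk_pow {R : Type*} [Ring R] (a b : R) :
    (1 - PowerSeries.C a * PowerSeries.X) * PowerSeries.mk (fun k => b ^ k) =
      1 + PowerSeries.X * PowerSeries.mk (fun k => (b - a) * b ^ k) := by
  ext k
  rw [sub_mul, one_mul, mul_assoc, map_sub, map_add, PowerSeries.coeff_C_mul]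
  cases k with
  | zero => simp
  | succ k =>
    rw [PowerSeries.coeff_succ_X_mul, PowerSeries.coeff_succ_X_mul]
    simp [PowerSeries.coeff_one, sub_mul, pow_succ']

theorem trace_seriesToeplitz_mul_transpose (d n : ℕ)
    (φ : PowerSeries (Matrix (Fin d) (Fin d) ℝ)) :
    trace (seriesToeplitz d n φ * (seriesToeplitz d n φ)ᵀ) =
      ∑ i ∈ Finset.range n, ∑ k ∈ Finset.range (i + 1),
        trace (PowerSeries.coeff k φ * (PowerSeries.coeff k φ)ᵀ) := by
  rw [← Fin.sum_univ_eq_sum_range (fun i => ∑ k ∈ Finset.range (i + 1),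
        trace (PowerSeries.coeff k φ * (PowerSeries.coeff k φ)ᵀ))]
  simp only [trace, diag_apply, Fintype.sum_prod_type]
  refine Finset.sum_congr rfl fun p _ => ?_
  rw [Finset.sum_comm]
  refine Finset.sum_congr rfl fun a _ => ?_
  rw [← sum_fin_le_eq_sum_range p.2
    (fun k => (PowerSeries.coeff k φ * (PowerSeries.coeff k φ)ᵀ) a a)]
  simp only [Matrix.mul_apply, Fintype.sum_prod_type, transpose_apply, seriesToeplitz]
  refine Finset.sum_congr rfl fun r _ => ?_
  split_ifs <;> simp

theorem trace_inv_mul_sub_one (d n : ℕ) (hd : 1 ≤ d) (hn : 1 ≤ n)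
    (A B : Matrix (Fin d) (Fin d) ℝ)
    (SA SB : Matrix (Fin n × Fin d) (Fin n × Fin d) ℝ)
    (hA : SA = blockToeplitz d n A * (blockToeplitz d n A)ᵀ)
    (hB : SB = blockToeplitz d n B * (blockToeplitz d n B)ᵀ) :
    Matrix.trace (SA⁻¹ * SB - 1) =
      Matrix.trace ((B - A)ᵀ * (B - A) *
        ∑ i ∈ Finset.range n, ∑ k ∈ Finset.range i, B ^ k * (B ^ k)ᵀ) := by
  have hinv : (blockToeplitz d n A)⁻¹ =
      seriesToeplitz d n (1 - PowerSeries.C A * PowerSeries.X) := by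
    refine Matrix.inv_eq_left_inv ?_
    rw [blockToeplitz_eq_seriesToeplitz, seriesToeplitz_mul, one_sub_C_mul_X_mul_mk_pow]
    have h : (PowerSeries.mk fun k => (A - A) * A ^ k) = 0 := by
      ext1 k
      simp
    rw [h, mul_zero, add_zero, seriesToeplitz_one]
  have hquot : (blockToeplitz d n A)⁻¹ * blockToeplitz d n B = seriesToeplitz d n
      (1 + PowerSeries.X * PowerSeries.mk (fun k => (B - A) * B ^ k)) := by
    rw [hinv, blockToeplitz_eq_seriesToeplitz, seriesToeplitz_mul, one_sub_C_mul_X_mul_mk_pow]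
  have htrace : trace (SA⁻¹ * SB) =
      trace (((blockToeplitz d n A)⁻¹ * blockToeplitz d n B) *
        ((blockToeplitz d n A)⁻¹ * blockToeplitz d n B)ᵀ) := by
    rw [hA, hB, Matrix.mul_inv_rev, transpose_mul, ← Matrix.transpose_nonsing_inv,
      Matrix.mul_assoc, trace_mul_comm]
    simp only [Matrix.mul_assoc]
  rw [trace_sub, htrace, hquot, trace_seriesToeplitz_mul_transpose]
  simp only [Finset.sum_range_succ', map_add, PowerSeries.coeff_succ_X_mul,
    PowerSeries.coeff_zero_X_mul, PowerSeries.coeff_one, PowerSeries.coeff_mk,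
    Nat.add_eq_zero_iff, one_ne_zero, and_false, if_false, if_true, zero_add, add_zero,
    Finset.sum_add_distrib, transpose_one, mul_one, trace_one, Finset.sum_const,
    Finset.card_range, Fintype.card_prod, Fintype.card_fin, nsmul_eq_mul, Nat.cast_mul,
    add_sub_cancel_right, Finset.mul_sum, trace_sum]
  refine Finset.sum_congr rfl fun i _ => Finset.sum_congr rfl fun k _ => ?_
  rw [transpose_mul, Matrix.mul_assoc (B - A)ᵀ, trace_mul_comm (B - A)ᵀ]
  simp only [Matrix.mul_assoc]
end
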